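/- (Maximum principle for the nonlocal conservation law, Theorem 3.2.) Let T > 0, let V : ℝ → ℝ be locally Lipschitz and nondecreasing, let q₀ ∈ L^∞(ℝ) have bounded total variation, and let γ_η be an admissible kernel. Then the unique weak solution q_η of the nonlocal conservation law ∂_t q + ∂_x(V(W[q,γ_η])q) = 0 with initial datum q₀ satisfies ‖q_η(t,·)‖_{L^∞(ℝ)} ≤ ‖q₀‖_{L^∞(ℝ)} for every t ∈ [0,T]. -/

import Mathlib

open MeasureTheory Set Filter Function

noncomputable section

/-- The nonlocal term `W[q,γ](t,x) = ∫_{-∞}^x γ(y-x) |q(t,y)| dy`. -/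
def nonlocalTerm (γ : ℝ → ℝ) (q : ℝ → ℝ → ℝ) (t x : ℝ) : ℝ :=
  ∫ y in Iic x, γ (y - x) * |q t y|

/-- The exponential kernel `γ_η(x) = exp(x/η)/η`. -/
def expKernel (η : ℝ) (x : ℝ) : ℝ := Real.exp (x / η) / η

/-- An admissible kernel: nonnegative, nondecreasing, convex, of bounded variation,
and of unit mass on `(-∞, 0]`. -/
structure AdmissibleKernel (γ : ℝ → ℝ) : Prop where
  nonneg : ∀ x ≤ (0:ℝ), 0 ≤ γ x
  mono : MonotoneOn γ (Iic (0:ℝ))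
  convex : ConvexOn ℝ (Iic (0:ℝ)) γ
  bv : BoundedVariationOn γ (Iic (0:ℝ))
  mass : (∫ x in Iic (0:ℝ), γ x) = 1

/-- A test function in `C¹_c([0,T) × ℝ)`. -/
structure IsTestFun (T : ℝ) (φ : ℝ → ℝ → ℝ) : Prop where
  smooth : ContDiff ℝ 1 (uncurry φ)
  compSupp : HasCompactSupport (uncurry φ)
  vanish : ∀ t x : ℝ, T ≤ t → φ t x = 0

/-- Membership in `C([0,T]; L¹_loc(ℝ)) ∩ L^∞(Ω_T)`. -/
structure InSolutionClass (T : ℝ) (q : ℝ → ℝ → ℝ) : Prop where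
  meas : Measurable (uncurry q)
  bdd : ∃ M : ℝ, ∀ t x : ℝ, |q t x| ≤ M
  timeCont : ∀ s ∈ Icc (0:ℝ) T, ∀ K : Set ℝ, IsCompact K →
    Tendsto (fun t => ∫ x in K, |q t x - q s x|) (nhdsWithin s (Icc (0:ℝ) T)) (nhds 0)

/-- Weak solution of the nonlocal conservation law
`∂ₜ q + ∂ₓ (V(W[q,γ]) q) = 0`, `q(0,·) = q₀`. -/
def IsWeakSolutionNonlocal (T : ℝ) (V γ q₀ : ℝ → ℝ) (q : ℝ → ℝ → ℝ) : Prop :=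
  ∀ φ : ℝ → ℝ → ℝ, IsTestFun T φ →
    (∫ t in Ioo (0:ℝ) T, ∫ x : ℝ, q t x *
        (deriv (fun s => φ s x) t + deriv (fun y => φ t y) x * V (nonlocalTerm γ q t x)))
      + (∫ x : ℝ, φ 0 x * q₀ x) = 0

/-- Strong solution: Lipschitz on `[0,T] × ℝ` and the PDE holds pointwise a.e. in `Ω_T`. -/
def IsStrongSolutionNonlocal (T : ℝ) (V γ q₀ : ℝ → ℝ) (q : ℝ → ℝ → ℝ) : Prop :=
  (∃ L : NNReal, LipschitzOnWith L (uncurry q) (Icc (0:ℝ) T ×ˢ (univ : Set ℝ))) ∧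
  (∀ x : ℝ, q 0 x = q₀ x) ∧
  (∀ᵐ p : ℝ × ℝ ∂(volume.restrict (Ioo (0:ℝ) T ×ˢ (univ : Set ℝ))),
    deriv (fun s => q s p.2) p.1
      + deriv (fun y => V (nonlocalTerm γ q p.1 y) * q p.1 y) p.2 = 0)

/-- The entropy functional `ℰ[φ,α,q]` (with entropy flux `β`). -/
def entropyE (T : ℝ) (q₀ : ℝ → ℝ) (α β : ℝ → ℝ) (φ : ℝ → ℝ → ℝ) (q : ℝ → ℝ → ℝ) : ℝ :=
  (∫ t in Ioo (0:ℝ) T, ∫ x : ℝ,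
      α (q t x) * deriv (fun s => φ s x) t + β (q t x) * deriv (fun y => φ t y) x)
    + ∫ x : ℝ, α (q₀ x) * φ 0 x

/-- Weak solution of the local conservation law `∂ₜ q + ∂ₓ (V(|q|) q) = 0`. -/
def IsWeakSolutionLocal (T : ℝ) (V q₀ : ℝ → ℝ) (q : ℝ → ℝ → ℝ) : Prop :=
  ∀ φ : ℝ → ℝ → ℝ, IsTestFun T φ →
    (∫ t in Ioo (0:ℝ) T, ∫ x : ℝ, q t x *
        (deriv (fun s => φ s x) t + deriv (fun y => φ t y) x * V |q t x|))
      + (∫ x : ℝ, φ 0 x * q₀ x) = 0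

/-- Entropy solution of the local conservation law. -/
def IsEntropySolutionLocal (T : ℝ) (V q₀ : ℝ → ℝ) (q : ℝ → ℝ → ℝ) : Prop :=
  ∀ α β : ℝ → ℝ, ContDiff ℝ 2 α → ConvexOn ℝ univ α → ContDiff ℝ 1 β →
    (∀ x : ℝ, deriv β x = deriv α x * deriv (fun y => y * V |y|) x) →
    ∀ φ : ℝ → ℝ → ℝ, IsTestFun T φ → (∀ t x : ℝ, 0 ≤ φ t x) →
      0 ≤ entropyE T q₀ α β φ q



/-- A continuous, bounded and spatially Lipschitz velocity field on `[0,T]` has a `C¹` integral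
curve through every point. -/
lemma exists_contDiff_characteristic {T : ℝ} (hT : 0 < T) {b : ℝ → ℝ → ℝ}
    (hc : Continuous (uncurry b)) {L B : NNReal} (hL : ∀ t, LipschitzWith L (b t))
    (hB : ∀ t x, |b t x| ≤ B) {t₀ : ℝ} (ht₀ : t₀ ∈ Icc 0 T) (x₀ : ℝ) :
    ∃ X : ℝ → ℝ, ContDiff ℝ 1 X ∧ X t₀ = x₀ ∧
      ∀ t ∈ Icc (0:ℝ) T, HasDerivAt X (b t (X t)) t := by
  have hPL : IsPicardLindelof b (⟨t₀, ht₀⟩ : Icc (0:ℝ) T) x₀ (B * ⟨T, hT.le⟩) 0 B L := by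
    refine ⟨fun t _ => (hL t).lipschitzOnWith, fun x _ => ?_, fun t _ x _ => ?_, ?_⟩
    · exact (hc.comp (continuous_id.prodMk continuous_const)).continuousOn
    · exact hB t x
    · simp only [NNReal.coe_zero, sub_zero]
      refine mul_le_mul_of_nonneg_left ?_ B.2
      exact max_le (by simpa using ht₀.1) (by simpa using ht₀.2)
  obtain ⟨α, hα₀, hα⟩ := hPL.exists_eq_forall_mem_Icc_hasDerivWithinAt₀
  simp only at hα₀
  have hαc : ContinuousOn α (Icc 0 T) := fun t ht => (hα t ht).continuousWithinAt
  set A : ℝ → ℝ := fun t => α (projIcc 0 T hT.le t) with hA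
  have hAc : Continuous A := by
    have := hαc.domRestrict.comp (continuous_projIcc (h := hT.le))
    exact this
  have hAeq : ∀ t ∈ Icc (0:ℝ) T, A t = α t := fun t ht => by
    simp [hA, projIcc_of_mem hT.le ht]
  set g : ℝ → ℝ := fun s => b s (A s) with hg
  have hgc : Continuous g := hc.comp (continuous_id.prodMk hAc)
  have hder : ∀ t, HasDerivAt (fun t => x₀ + ∫ s in t₀..t, g s) (g t) t := fun t =>
    (intervalIntegral.integral_hasDerivAt_right (hgc.intervalIntegrable _ _)
      (hgc.stronglyMeasurableAtFilter _ _) hgc.continuousAt).const_add x₀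
  have hXα : ∀ t ∈ Icc (0:ℝ) T, x₀ + ∫ s in t₀..t, g s = α t := by
    intro t ht
    have hsub : uIcc t₀ t ⊆ Icc 0 T := by
      rw [← uIcc_of_le hT.le] at ht₀ ht ⊢
      exact uIcc_subset_uIcc ht₀ ht
    have hderα : ∀ s ∈ Ioo (min t₀ t) (max t₀ t), HasDerivAt α (g s) s := by
      intro s hs
      have hs' : s ∈ Ioo 0 T := ⟨(le_min ht₀.1 ht.1).trans_lt hs.1, hs.2.trans_le (max_le ht₀.2 ht.2)⟩
      have := (hα s (Ioo_subset_Icc_self hs')).hasDerivAt (Icc_mem_nhds hs'.1 hs'.2)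
      simpa [hg, hAeq s (Ioo_subset_Icc_self hs')] using this
    have := intervalIntegral.integral_eq_sub_of_hasDeriv_right
      (hαc.mono hsub) (fun s hs => (hderα s hs).hasDerivWithinAt) (hgc.intervalIntegrable _ _)
    rw [this, hα₀]; ring
  refine ⟨fun t => x₀ + ∫ s in t₀..t, g s, ?_, by simp, fun t ht => ?_⟩
  · rw [contDiff_one_iff_deriv]
    refine ⟨fun t => (hder t).differentiableAt, ?_⟩
    have : deriv (fun t => x₀ + ∫ s in t₀..t, g s) = g := funext fun t => (hder t).deriv
    rwa [this]
  · have := hder t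
    simp only [hXα t ht]
    simpa [hg, hAeq t ht] using this

/-- A function whose integrals over short intervals are at most `R` times the length is almost
everywhere bounded by `R`. -/
lemma ae_abs_le_of_forall_intervalIntegral_le {f : ℝ → ℝ} (hf : LocallyIntegrable f volume)
    {R δ : ℝ} (hδ : 0 < δ)
    (h : ∀ a b, a < b → b - a ≤ δ → |∫ x in a..b, f x| ≤ R * (b - a)) :
    ∀ᵐ x, |f x| ≤ R := by
  have hR : 0 ≤ R := by
    have h1 := (abs_nonneg _).trans (h 0 δ hδ (by simp))
    simp only [sub_zero] at h1
    exact nonneg_of_mul_nonneg_left h1 hδ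
  filter_upwards [LocallyIntegrable.ae_hasDerivAt_integral hf] with x hx
  refine (hx x).le_of_lip' hR ?_
  filter_upwards [Ioo_mem_nhds (sub_lt_self x hδ) (lt_add_of_pos_right x hδ)] with y hy
  rw [intervalIntegral.integral_same, sub_zero, Real.norm_eq_abs, Real.norm_eq_abs]
  rcases lt_trichotomy x y with hxy | rfl | hxy
  · rw [abs_of_pos (sub_pos.2 hxy)]
    exact h x y hxy (by linarith [hy.2])
  · simp
  · rw [intervalIntegral.integral_symm, abs_neg, abs_sub_comm, abs_of_pos (sub_pos.2 hxy)]
    exact h y x hxy (by linarith [hy.1])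

/-- Extending the kernel by zero turns the nonlocal term into an integral over the line. -/
lemma setIntegral_kernel_eq (γ f : ℝ → ℝ) (x : ℝ) :
    (∫ y in Iic x, γ (y - x) * f y) = ∫ y, (Iic (0:ℝ)).indicator γ (y - x) * f y := by
  rw [← integral_indicator measurableSet_Iic]
  congr 1 with y
  by_cases hy : y ≤ x <;> simp [hy]

/-- Translates of an integrable kernel times a bounded function are integrable. -/
lemma integrable_comp_sub_mul {k f : ℝ → ℝ} (hk : Integrable k) (hf : Measurable f) {S : ℝ}
    (hfS : ∀ᵐ y, |f y| ≤ S) (x : ℝ) : Integrable fun y => k (y - x) * f y :=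
  (hk.comp_sub_right x).mul_bdd hf.aestronglyMeasurable hfS

/-- Convolution with a monotone kernel: increments are bounded above by the mass entering, and
below by the weighted mass entering minus the worst-case loss. -/
lemma kernel_increment_bounds {γ f : ℝ → ℝ} (hmono : MonotoneOn γ (Iic 0))
    (hnn : ∀ x ≤ 0, 0 ≤ γ x) (hγint : IntegrableOn γ (Iic 0)) {G S : ℝ}
    (hG : ∀ x < 0, γ x ≤ G) (hf : Measurable f) (hf0 : ∀ y, 0 ≤ f y) (hfS : ∀ᵐ y, f y ≤ S)
    {a b : ℝ} (hab : a ≤ b) :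
    (∫ y in Iic b, γ (y - b) * f y) - (∫ y in Iic a, γ (y - a) * f y) ≤ S * G * (b - a) ∧
    γ (a - b) * (∫ y in a..b, f y) - S * G * (b - a) ≤
      (∫ y in Iic b, γ (y - b) * f y) - (∫ y in Iic a, γ (y - a) * f y) := by
  set k := (Iic (0:ℝ)).indicator γ with hk
  have hki : Integrable k := (integrable_indicator_iff measurableSet_Iic).2 hγint
  have hfS' : ∀ᵐ y, |f y| ≤ S := by
    filter_upwards [hfS] with y hy
    rwa [abs_of_nonneg (hf0 y)]
  have hG0 : 0 ≤ G := (hnn (-1) (by norm_num)).trans (hG (-1) (by norm_num))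
  have hI : ∀ x, Integrable fun y => k (y - x) * f y := integrable_comp_sub_mul hki hf hfS'
  rw [setIntegral_kernel_eq, setIntegral_kernel_eq, ← integral_sub (hI b) (hI a)]
  have hk0 : ∫ y, (k (y - b) - k (y - a)) = 0 := by
    rw [integral_sub (hki.comp_sub_right b) (hki.comp_sub_right a),
      integral_sub_right_eq_self k, integral_sub_right_eq_self k, sub_self]
  have hIoc : Integrable ((Ioc a b).indicator fun _ => S * G) :=
    (integrable_indicator_iff measurableSet_Ioc).2 (integrableOn_const (by simp))
  have hIocv : ∫ y, (Ioc a b).indicator (fun _ => S * G) y = S * G * (b - a) := by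
    rw [integral_indicator measurableSet_Ioc, setIntegral_const]
    simp [hab, mul_comm]
  have hfI : Integrable ((Ioc a b).indicator fun y => γ (a - b) * f y) := by
    rw [integrable_indicator_iff measurableSet_Ioc]
    refine Integrable.const_mul ?_ _
    exact Measure.integrableOn_of_bounded (M := S) (by simp) hf.aestronglyMeasurable
      (ae_restrict_of_ae hfS')
  have hfIv : ∫ y, (Ioc a b).indicator (fun y => γ (a - b) * f y) y =
      γ (a - b) * ∫ y in a..b, f y := by
    rw [integral_indicator measurableSet_Ioc, integral_const_mul,
      intervalIntegral.integral_of_le hab]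
  have hne : ∀ᵐ y : ℝ, y ≠ b := by simp [ae_iff]
  constructor
  · rw [← hIocv]
    refine integral_mono_ae ((hI b).sub (hI a)) hIoc ?_
    filter_upwards [hfS, hne] with y hy hyb
    rcases le_or_gt y a with hya | hya
    · have h1 : k (y - b) ≤ k (y - a) := by
        simp only [hk, indicator, mem_Iic]
        rw [if_pos (by linarith), if_pos (by linarith)]
        exact hmono (by simp; linarith) (by simp; linarith) (by linarith)
      have : y ∉ Ioc a b := fun h => by linarith [h.1]
      simp only [indicator, this, if_false]
      nlinarith [hf0 y]
    · have h1 : k (y - a) = 0 := by simp [hk, hya]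
      rcases le_or_gt y b with hyb' | hyb'
      · have h2 : k (y - b) = γ (y - b) := by simp [hk, hyb']
        have h3 := hG (y - b) (by have := lt_of_le_of_ne hyb' hyb; linarith)
        have h4 := hnn (y - b) (by linarith)
        have : y ∈ Ioc a b := ⟨hya, hyb'⟩
        simp only [indicator, this, if_true, h1, h2]
        nlinarith [hf0 y]
      · have h2 : k (y - b) = 0 := by simp [hk, hyb']
        have : y ∉ Ioc a b := fun h => by linarith [h.2]
        simp [indicator, this, h1, h2]
  · have hlow : ∫ y, (S * (k (y - b) - k (y - a)) +
        ((Ioc a b).indicator (fun y => γ (a - b) * f y) y -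
          (Ioc a b).indicator (fun _ => S * G) y)) =
        γ (a - b) * (∫ y in a..b, f y) - S * G * (b - a) := by
      rw [integral_add (g := fun y => (Ioc a b).indicator (fun y => γ (a - b) * f y) y -
        (Ioc a b).indicator (fun _ => S * G) y) _ (hfI.sub hIoc), integral_const_mul, hk0, integral_sub hfI hIoc, hIocv,
        hfIv]
      · ring
      · exact ((hki.comp_sub_right b).sub (hki.comp_sub_right a)).const_mul S
    rw [← hlow]
    refine integral_mono_ae
      ((((hki.comp_sub_right b).sub (hki.comp_sub_right a)).const_mul S).add (hfI.sub hIoc))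
      ((hI b).sub (hI a)) ?_
    filter_upwards [hfS, hne] with y hy hyb
    rcases le_or_gt y a with hya | hya
    · have h1 : k (y - b) ≤ k (y - a) := by
        simp only [hk, indicator, mem_Iic]
        rw [if_pos (by linarith), if_pos (by linarith)]
        exact hmono (by simp; linarith) (by simp; linarith) (by linarith)
      have : y ∉ Ioc a b := fun h => by linarith [h.1]
      simp only [indicator, this, if_false]
      nlinarith [hf0 y]
    · have h1 : k (y - a) = 0 := by simp [hk, hya]
      rcases le_or_gt y b with hyb' | hyb'
      · have h2 : k (y - b) = γ (y - b) := by simp [hk, hyb']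
        have h3 := hG (y - b) (by have := lt_of_le_of_ne hyb' hyb; linarith)
        have h4 : γ (a - b) ≤ γ (y - b) :=
          hmono (by simp; linarith) (by simp; linarith) (by linarith)
        have : y ∈ Ioc a b := ⟨hya, hyb'⟩
        simp only [indicator, this, if_true, h1, h2]
        nlinarith [hf0 y]
      · have h2 : k (y - b) = 0 := by simp [hk, hyb']
        have : y ∉ Ioc a b := fun h => by linarith [h.2]
        simp [indicator, this, h1, h2]

/-- Dependence of the nonlocal term on the density: a local `L¹` term plus the tail of the kernel. -/
lemma abs_kernel_integral_sub_le {γ f g : ℝ → ℝ} (hmono : MonotoneOn γ (Iic 0))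
    (hnn : ∀ x ≤ 0, 0 ≤ γ x) (hγint : IntegrableOn γ (Iic 0)) (hf : Measurable f)
    (hg : Measurable g) {M : ℝ} (hfM : ∀ y, |f y| ≤ M) (hgM : ∀ y, |g y| ≤ M) (x : ℝ) {R : ℝ}
    (hR : 0 ≤ R) :
    |(∫ y in Iic x, γ (y - x) * f y) - ∫ y in Iic x, γ (y - x) * g y| ≤
      γ 0 * (∫ y in Icc (x - R) x, |f y - g y|) +
        2 * M * ((∫ y in Iic 0, γ y) - ∫ y in -R..0, γ y) := by
  set k := (Iic (0:ℝ)).indicator γ with hk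
  have hki : Integrable k := (integrable_indicator_iff measurableSet_Iic).2 hγint
  have hM : 0 ≤ M := (abs_nonneg _).trans (hfM 0)
  have hfi := integrable_comp_sub_mul hki hf (Eventually.of_forall hfM) x
  have hgi := integrable_comp_sub_mul hki hg (Eventually.of_forall hgM) x
  set k₁ := (Ioc (-R) 0).indicator k with hk₁
  have hk₁i : Integrable k₁ := hki.indicator measurableSet_Ioc
  have htail : ∫ y, (k (y - x) - k₁ (y - x)) = (∫ y in Iic 0, γ y) - ∫ y in -R..0, γ y := by
    rw [integral_sub (hki.comp_sub_right x) (hk₁i.comp_sub_right x),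
      integral_sub_right_eq_self k, integral_sub_right_eq_self k₁, hk,
      integral_indicator measurableSet_Iic, hk₁, integral_indicator measurableSet_Ioc,
      intervalIntegral.integral_of_le (by linarith), hk]
    congr 1
    refine setIntegral_congr_fun measurableSet_Ioc fun y hy => ?_
    simp [hy.2]
  have hloc : Integrable ((Icc (x - R) x).indicator fun y => γ 0 * |f y - g y|) := by
    rw [integrable_indicator_iff measurableSet_Icc]
    refine Integrable.const_mul ?_ _
    refine Measure.integrableOn_of_bounded (M := 2 * M) (by simp)
      (hf.sub hg).norm.aestronglyMeasurable (ae_of_all _ fun y => ?_)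
    rw [Real.norm_eq_abs, abs_abs]
    linarith [abs_sub (f y) (g y), hfM y, hgM y]
  have htI : Integrable fun y => 2 * M * (k (y - x) - k₁ (y - x)) :=
    ((hki.comp_sub_right x).sub (hk₁i.comp_sub_right x)).const_mul _
  rw [setIntegral_kernel_eq, setIntegral_kernel_eq, ← integral_sub hfi hgi, ← htail,
    ← integral_const_mul, ← integral_const_mul, ← integral_indicator measurableSet_Icc,
    ← integral_add hloc htI]
  rw [← Real.norm_eq_abs]
  refine norm_integral_le_of_norm_le
    (hloc.add htI) (ae_of_all _ fun y => ?_)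
  have hD : |f y - g y| ≤ 2 * M := by linarith [abs_sub (f y) (g y), hfM y, hgM y]
  rw [← mul_sub, norm_mul, Real.norm_eq_abs, Real.norm_eq_abs]
  rcases le_or_gt y x with hyx | hyx
  · have hky : k (y - x) = γ (y - x) := by simp [hk, hyx]
    have h0 : 0 ≤ γ (y - x) := hnn _ (by linarith)
    have h1 : γ (y - x) ≤ γ 0 := hmono (by simp; linarith) (by simp) (by linarith)
    rw [hky, abs_of_nonneg h0]
    rcases lt_or_ge (x - R) y with hy | hy
    · have e1 : k₁ (y - x) = γ (y - x) := by
        rw [hk₁, indicator_of_mem (show y - x ∈ Ioc (-R) 0 from ⟨by linarith, by linarith⟩), hky]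
      rw [indicator_of_mem (show y ∈ Icc (x - R) x from ⟨hy.le, hyx⟩), e1]
      nlinarith [abs_nonneg (f y - g y)]
    · have e1 : k₁ (y - x) = 0 := by
        rw [hk₁, indicator_of_notMem]
        exact fun h => by linarith [h.1]
      have e2 : 0 ≤ (Icc (x - R) x).indicator (fun y => γ 0 * |f y - g y|) y :=
        indicator_nonneg (fun z _ => mul_nonneg (h0.trans h1) (abs_nonneg _)) _
      rw [e1]
      nlinarith [abs_nonneg (f y - g y)]
  · have hky : k (y - x) = 0 := by simp [hk, hyx]
    have e1 : k₁ (y - x) = 0 := by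
      rw [hk₁, indicator_of_notMem]
      exact fun h => by linarith [h.2]
    rw [hky, e1, indicator_of_notMem (fun h => by linarith [h.2])]
    simp

/-- The nonlocal term depends continuously on time. -/
lemma continuousOn_nonlocalTerm {T : ℝ} {γ : ℝ → ℝ} {q : ℝ → ℝ → ℝ}
    (hγ : AdmissibleKernel γ) (hγint : IntegrableOn γ (Iic 0)) (hq : InSolutionClass T q) (x : ℝ) :
    ContinuousOn (fun t => nonlocalTerm γ q t x) (Icc 0 T) := by
  obtain ⟨M, hM⟩ := hq.bdd
  have hqt : ∀ t, Measurable (q t) := fun t => hq.meas.comp measurable_prodMk_left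
  have hM0 : 0 ≤ M := (abs_nonneg _).trans (hM 0 0)
  intro s hs
  have hlim : Tendsto (fun R : ℝ => 2 * M * ((∫ y in Iic 0, γ y) - ∫ y in -R..0, γ y)) atTop
      (nhds 0) := by
    have := intervalIntegral_tendsto_integral_Iic 0 hγint tendsto_neg_atTop_atBot
    simpa using (this.const_sub (∫ y in Iic 0, γ y)).const_mul (2 * M)
  rw [ContinuousWithinAt, Metric.tendsto_nhds]
  intro ε hε
  obtain ⟨R, hRε, hR⟩ :=
    ((hlim.eventually (gt_mem_nhds (half_pos hε))).and (eventually_ge_atTop 0)).exists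
  have hloc := ((hq.timeCont s hs (Icc (x - R) x) isCompact_Icc).const_mul (γ 0)).eventually
    (gt_mem_nhds (show γ 0 * 0 < ε / 2 by simpa using half_pos hε))
  filter_upwards [hloc] with t ht
  rw [Real.dist_eq]
  have habs : ∀ t, ∀ y, |(|q t y|)| ≤ M := fun t y => by rw [abs_abs]; exact hM t y
  have h1 := abs_kernel_integral_sub_le hγ.mono hγ.nonneg hγint (hqt t).abs (hqt s).abs (habs t)
    (habs s) x hR
  have h2 : (∫ y in Icc (x - R) x, |(|q t y| - |q s y|)|) ≤
      ∫ y in Icc (x - R) x, |q t y - q s y| := by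
    refine integral_mono_of_nonneg (ae_of_all _ fun y => abs_nonneg _) ?_
      (ae_of_all _ fun y => abs_abs_sub_abs_le _ _)
    refine Measure.integrableOn_of_bounded (M := 2 * M) (by simp)
      ((hqt t).sub (hqt s)).norm.aestronglyMeasurable (ae_of_all _ fun y => ?_)
    rw [Real.norm_eq_abs, abs_abs]
    linarith [abs_sub (q t y) (q s y), hM t y, hM s y]
  have h3 := mul_le_mul_of_nonneg_left h2 (hγ.nonneg 0 le_rfl)
  simp only [nonlocalTerm]
  linarith

/-- The weak formulation in time forces a continuous function to be constant. -/
lemma eqOn_const_of_weak_deriv_eq_zero {T : ℝ} (hT : 0 < T) {F : ℝ → ℝ} {c : ℝ}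
    (hF : ContinuousOn F (Icc 0 T))
    (h : ∀ ψ : ℝ → ℝ, ContDiff ℝ 1 ψ → HasCompactSupport ψ → (∀ t, T ≤ t → ψ t = 0) →
      (∫ t in Ioo 0 T, deriv ψ t * F t) + ψ 0 * c = 0) :
    EqOn F (fun _ => c) (Icc 0 T) := by
  refine Measure.eqOn_Icc_of_ae_eq volume hT.ne ?_ hF continuousOn_const
  rw [← restrict_Ioo_eq_restrict_Icc]
  have hFi : IntegrableOn (fun t => F t - c) (Ioo 0 T) :=
    ((hF.sub continuousOn_const).integrableOn_Icc).mono_set Ioo_subset_Icc_self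
  have key := isOpen_Ioo.ae_eq_zero_of_integral_contDiff_smul_eq_zero (μ := volume)
    (f := fun t => F t - c) (U := Ioo 0 T) hFi.locallyIntegrableOn ?_
  · refine (ae_restrict_iff' measurableSet_Ioo).2 ?_
    filter_upwards [key] with t ht ht'
    exact sub_eq_zero.1 (ht ht')
  intro g hg hgc hgs
  have hg0 : ∀ t, t ∉ Ioo 0 T → g t = 0 := fun t ht =>
    image_eq_zero_of_notMem_tsupport fun h' => ht (hgs h')
  have hgcont := hg.continuous
  set P : ℝ → ℝ := fun t => ∫ s in T..t, g s with hP
  have hPd : ∀ t, HasDerivAt P (g t) t := fun t =>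
    intervalIntegral.integral_hasDerivAt_right (hgcont.intervalIntegrable _ _)
      (hgcont.stronglyMeasurableAtFilter _ _) hgcont.continuousAt
  have hP1 : ContDiff ℝ 1 P := by
    rw [contDiff_one_iff_deriv]
    refine ⟨fun t => (hPd t).differentiableAt, ?_⟩
    rwa [show deriv P = g from funext fun t => (hPd t).deriv]
  have hPT : ∀ t, T ≤ t → P t = 0 := by
    intro t ht
    rw [hP]
    simp only
    rw [intervalIntegral.integral_of_le ht]
    refine setIntegral_eq_zero_of_forall_eq_zero fun s hs => hg0 s fun h' => ?_
    linarith [hs.1, h'.2]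
  have hP0 : P 0 = - ∫ t in Ioo 0 T, g t := by
    rw [hP]
    simp only
    rw [intervalIntegral.integral_symm, intervalIntegral.integral_of_le hT.le,
      integral_Ioc_eq_integral_Ioo]
  set H : ℝ → ℝ := fun t => Real.smoothTransition (t + 2) with hH
  have hH1 : ContDiff ℝ 1 H := Real.smoothTransition.contDiff.comp (contDiff_id.add contDiff_const)
  have hψ := h (fun t => P t * H t) (hP1.mul hH1) ?_ ?_
  · have hd : ∀ t ∈ Ioo 0 T, deriv (fun t => P t * H t) t = g t := by
      intro t ht
      have : (fun t => P t * H t) =ᶠ[nhds t] P := by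
        filter_upwards [lt_mem_nhds ht.1] with s hs
        simp only [hH]
        rw [Real.smoothTransition.one_of_one_le (by linarith), mul_one]
      rw [this.deriv_eq, (hPd t).deriv]
    rw [setIntegral_congr_fun measurableSet_Ioo (g := fun t => g t * F t)
      (fun t ht => by simp only [hd t ht])] at hψ
    simp only [hP0, hH, zero_add] at hψ
    rw [Real.smoothTransition.one_of_one_le (by norm_num), mul_one] at hψ
    have e1 : ∫ t, g t • (F t - c) = ∫ t in Ioo 0 T, g t • (F t - c) := by
      rw [setIntegral_eq_integral_of_forall_compl_eq_zero]
      intro t ht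
      simp [hg0 t ht]
    rw [e1]
    simp only [smul_eq_mul, mul_sub]
    rw [integral_sub, integral_mul_const]
    · linarith
    · exact ((hgcont.continuousOn.mul hF).integrableOn_Icc).mono_set Ioo_subset_Icc_self
    · exact ((hgcont.mul continuous_const).continuousOn.integrableOn_Icc).mono_set
        Ioo_subset_Icc_self
  · refine HasCompactSupport.intro (isCompact_Icc (a := -2) (b := T)) fun t ht => ?_
    rcases lt_or_ge T t with h' | h'
    · simp [hPT t h'.le]
    · have : t < -2 := by
        by_contra hcon
        exact ht ⟨not_lt.1 hcon, h'⟩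
      simp only [hH]
      rw [Real.smoothTransition.zero_of_nonpos (by linarith), mul_zero]
  · intro t ht
    simp [hPT t ht]

/-- Integrals over intervals with continuously moving endpoints are continuous in time. -/
lemma continuousOn_integral_moving {T : ℝ} {q : ℝ → ℝ → ℝ} (hq : InSolutionClass T q)
    {X Y : ℝ → ℝ} (hX : Continuous X) (hY : Continuous Y) :
    ContinuousOn (fun t => ∫ x in X t..Y t, q t x) (Icc 0 T) := by
  obtain ⟨M, hM⟩ := hq.bdd
  have hqt : ∀ t, Measurable (q t) := fun t => hq.meas.comp measurable_prodMk_left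
  have hqi : ∀ t a c, IntervalIntegrable (q t) volume a c := fun t a c => by
    rw [intervalIntegrable_iff]
    exact Measure.integrableOn_of_bounded (M := M) (by simp [uIoc])
      (hqt t).aestronglyMeasurable (ae_of_all _ (hM t))
  intro s hs
  set K := Icc (min (X s) (Y s) - 1) (max (X s) (Y s) + 1) with hK
  have hlim : Tendsto (fun t => (∫ x in K, |q t x - q s x|) + M * |X t - X s| + M * |Y t - Y s|)
      (nhdsWithin s (Icc 0 T)) (nhds 0) := by
    have h1 := hq.timeCont s hs K isCompact_Icc
    have h2 : Tendsto (fun t => M * |X t - X s|) (nhdsWithin s (Icc 0 T)) (nhds 0) := by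
      have : Continuous fun t => M * |X t - X s| := by fun_prop
      simpa using (this.tendsto s).mono_left nhdsWithin_le_nhds
    have h3 : Tendsto (fun t => M * |Y t - Y s|) (nhdsWithin s (Icc 0 T)) (nhds 0) := by
      have : Continuous fun t => M * |Y t - Y s| := by fun_prop
      simpa using (this.tendsto s).mono_left nhdsWithin_le_nhds
    simpa using (h1.add h2).add h3
  rw [ContinuousWithinAt, tendsto_iff_dist_tendsto_zero]
  refine squeeze_zero' (Eventually.of_forall fun _ => dist_nonneg) ?_ hlim
  have hXn : ∀ᶠ t in nhdsWithin s (Icc 0 T), |X t - X s| < 1 :=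
    (hX.tendsto s).mono_left nhdsWithin_le_nhds (Metric.ball_mem_nhds _ one_pos)
  have hYn : ∀ᶠ t in nhdsWithin s (Icc 0 T), |Y t - Y s| < 1 :=
    (hY.tendsto s).mono_left nhdsWithin_le_nhds (Metric.ball_mem_nhds _ one_pos)
  filter_upwards [hXn, hYn] with t hXt hYt
  have hsplit : (∫ x in X t..Y t, q t x) - ∫ x in X s..Y s, q s x =
      (∫ x in X t..Y t, (q t x - q s x)) - (∫ x in X s..X t, q s x) + ∫ x in Y s..Y t, q s x := by
    rw [intervalIntegral.integral_sub (hqi _ _ _) (hqi _ _ _)]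
    have h1 := intervalIntegral.integral_add_adjacent_intervals (hqi s (X s) (X t))
      (hqi s (X t) (Y t))
    have h2 := intervalIntegral.integral_add_adjacent_intervals (hqi s (X s) (Y s))
      (hqi s (Y s) (Y t))
    linarith
  have hb : ∀ a c, |∫ x in a..c, q s x| ≤ M * |c - a| := fun a c => by
    rw [← Real.norm_eq_abs]
    exact intervalIntegral.norm_integral_le_of_norm_le_const fun x _ => hM s x
  have hd : |∫ x in X t..Y t, (q t x - q s x)| ≤ ∫ x in K, |q t x - q s x| := by
    rw [← Real.norm_eq_abs]
    refine intervalIntegral.norm_integral_le_integral_norm_uIoc.trans ?_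
    refine setIntegral_mono_set ?_ (ae_of_all _ fun _ => abs_nonneg _) ?_
    · refine Measure.integrableOn_of_bounded (M := 2 * M) (by simp [hK])
        ((hqt t).sub (hqt s)).norm.aestronglyMeasurable (ae_of_all _ fun y => ?_)
      rw [norm_norm, Real.norm_eq_abs]
      linarith [abs_sub (q t y) (q s y), hM t y, hM s y]
    · refine (show uIoc (X t) (Y t) ⊆ K from ?_).eventuallyLE
      rw [abs_lt] at hXt hYt
      intro x hx
      rw [mem_uIoc] at hx
      have a1 := min_le_left (X s) (Y s)
      have a2 := min_le_right (X s) (Y s)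
      have a3 := le_max_left (X s) (Y s)
      have a4 := le_max_right (X s) (Y s)
      rcases hx with hx | hx <;> constructor <;> linarith [hx.1, hx.2]
  rw [Real.dist_eq, hsplit]
  have h1 := hb (X s) (X t)
  have h2 := hb (Y s) (Y t)
  rw [abs_le] at *
  constructor <;> linarith [hd.1, hd.2, h1.1, h1.2, h2.1, h2.2]

/-- The derivative of the smooth step is bounded and vanishes outside `(0, 1]`. -/
lemma exists_bound_deriv_smoothTransition :
    ∃ C : ℝ, 0 ≤ C ∧
      ∀ x, |deriv Real.smoothTransition x| ≤ (Ioc (0:ℝ) 1).indicator (fun _ => C) x := by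
  have hcont : Continuous (deriv Real.smoothTransition) :=
    (Real.smoothTransition.contDiff (n := 1)).continuous_deriv le_rfl
  obtain ⟨C, hC⟩ := isCompact_Icc.exists_bound_of_continuousOn (s := Icc (0:ℝ) 1)
    hcont.continuousOn
  refine ⟨C, (norm_nonneg _).trans (hC 0 (by simp)), fun x => ?_⟩
  by_cases hx : x ∈ Ioc (0:ℝ) 1
  · rw [indicator_of_mem hx]
    exact hC x (Ioc_subset_Icc_self hx)
  · rw [indicator_of_notMem hx, abs_nonpos_iff]
    rcases le_or_gt x 0 with h0 | h0
    · have hleft : EqOn (deriv Real.smoothTransition) (fun _ => 0) (Iio 0) := fun y hy => by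
        have : Real.smoothTransition =ᶠ[nhds y] fun _ => 0 := by
          filter_upwards [gt_mem_nhds hy] with z hz
          exact Real.smoothTransition.zero_of_nonpos (le_of_lt hz)
        rw [this.deriv_eq, deriv_const]
      have := hleft.closure hcont continuous_const
      rw [closure_Iio] at this
      exact this h0
    · have h1 : 1 < x := by
        by_contra h
        exact hx ⟨h0, not_lt.1 h⟩
      have : Real.smoothTransition =ᶠ[nhds x] fun _ => 1 := by
        filter_upwards [lt_mem_nhds h1] with z hz
        exact Real.smoothTransition.one_of_one_le (le_of_lt hz)
      rw [this.deriv_eq, deriv_const]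

/-- The rescaled smooth step differs from the sharp step only on `(a, a + ε]`. -/
lemma abs_smoothTransition_sub_indicator_le {ε : ℝ} (hε : 0 < ε) (a x : ℝ) :
    |Real.smoothTransition ((x - a) / ε) - (Ioi a).indicator (fun _ => (1:ℝ)) x| ≤
      (Ioc a (a + ε)).indicator (fun _ => (1:ℝ)) x := by
  rcases le_or_gt x a with h | h
  · rw [Real.smoothTransition.zero_of_nonpos (div_nonpos_of_nonpos_of_nonneg (by linarith) hε.le),
      indicator_of_notMem (by simpa using h), indicator_of_notMem (fun h' => by linarith [h'.1])]
    simp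
  · rw [indicator_of_mem (show x ∈ Ioi a from h)]
    rcases le_or_gt x (a + ε) with h2 | h2
    · rw [indicator_of_mem (show x ∈ Ioc a (a + ε) from ⟨h, h2⟩), abs_le]
      constructor <;> linarith [Real.smoothTransition.nonneg ((x - a) / ε),
        Real.smoothTransition.le_one ((x - a) / ε)]
    · rw [Real.smoothTransition.one_of_one_le ((one_le_div hε).2 (by linarith)),
        indicator_of_notMem (fun h' => by linarith [h'.2])]
      simp

/-- The integral of a bounded function against a difference of sharp steps. -/
lemma integral_mul_indicator_Ioi_sub {f : ℝ → ℝ} (hf : Measurable f) {M : ℝ}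
    (hM : ∀ x, |f x| ≤ M) (a c : ℝ) :
    Integrable (fun x => f x * ((Ioi a).indicator (fun _ => (1:ℝ)) x -
      (Ioi c).indicator (fun _ => (1:ℝ)) x)) ∧
    ∫ x, f x * ((Ioi a).indicator (fun _ => (1:ℝ)) x - (Ioi c).indicator (fun _ => (1:ℝ)) x) =
      ∫ x in a..c, f x := by
  have hI : ∀ u v : ℝ, Integrable ((Ioc u v).indicator f) := fun u v => by
    rw [integrable_indicator_iff measurableSet_Ioc]
    exact Measure.integrableOn_of_bounded (M := M) (by simp) hf.aestronglyMeasurable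
      (ae_of_all _ hM)
  have heq : (fun x => f x * ((Ioi a).indicator (fun _ => (1:ℝ)) x -
      (Ioi c).indicator (fun _ => (1:ℝ)) x)) =
      fun x => (Ioc a c).indicator f x - (Ioc c a).indicator f x := by
    funext x
    simp only [indicator, mem_Ioi, mem_Ioc]
    rcases le_or_gt x a with h1 | h1 <;> rcases le_or_gt x c with h2 | h2 <;>
      simp [h1, h2, not_lt.2, not_le.2]
  rw [heq]
  refine ⟨(hI a c).sub (hI c a), ?_⟩
  rw [integral_sub (hI a c) (hI c a), integral_indicator measurableSet_Ioc,
    integral_indicator measurableSet_Ioc, intervalIntegral]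

/-- A function dominated by a constant on two intervals of length `ε` has a small integral. -/
lemma integrable_and_abs_integral_le_of_two_intervals {g : ℝ → ℝ} (hg : Measurable g)
    {a c ε C : ℝ} (hε : 0 < ε)
    (h : ∀ x, |g x| ≤ (Ioc a (a + ε)).indicator (fun _ => C) x +
      (Ioc c (c + ε)).indicator (fun _ => C) x) :
    Integrable g ∧ |∫ x, g x| ≤ 2 * C * ε := by
  have hI : ∀ u : ℝ, Integrable ((Ioc u (u + ε)).indicator fun _ => C) := fun u =>
    (integrable_indicator_iff measurableSet_Ioc).2 (integrableOn_const (by simp))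
  have hv : ∀ u : ℝ, ∫ x, (Ioc u (u + ε)).indicator (fun _ => C) x = C * ε := fun u => by
    rw [integral_indicator measurableSet_Ioc, setIntegral_const]
    simp [hε.le, mul_comm]
  refine ⟨((hI a).add (hI c)).mono' hg.aestronglyMeasurable (ae_of_all _ h), ?_⟩
  have := norm_integral_le_of_norm_le (f := g) ((hI a).add (hI c)) (ae_of_all _ h)
  simp only [Pi.add_apply] at this
  rw [integral_add (hI a) (hI c), hv, hv, Real.norm_eq_abs] at this
  linarith

/-- Pointwise bound for the error made by a smooth step moving with a prescribed velocity. -/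
lemma boundary_layer_bound {C : ℝ} (hC : ∀ x, |deriv Real.smoothTransition x| ≤
      (Ioc (0:ℝ) 1).indicator (fun _ => C) x) {ε M A L : ℝ} (hε : 0 < ε) (hL : 0 ≤ L)
    {u p p' v v' x z : ℝ} (hu : |u| ≤ M) (hp : |p| ≤ A) (hp' : |p'| ≤ A)
    (hv : |v - v'| ≤ L * |x - z|) :
    |u * (p' * (Real.smoothTransition ((x - z) / ε) - (Ioi z).indicator (fun _ => (1:ℝ)) x) +
      p * (deriv Real.smoothTransition ((x - z) / ε) * (1 / ε) * (v - v')))| ≤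
      (Ioc z (z + ε)).indicator (fun _ => M * (A + A * (C * L))) x := by
  have hj := abs_smoothTransition_sub_indicator_le hε z x
  have hd := hC ((x - z) / ε)
  by_cases hx : x ∈ Ioc z (z + ε)
  · have hx' : (x - z) / ε ∈ Ioc (0:ℝ) 1 :=
      ⟨div_pos (by linarith [hx.1]) hε, (div_le_one hε).2 (by linarith [hx.2])⟩
    rw [indicator_of_mem hx] at hj ⊢
    rw [indicator_of_mem hx'] at hd
    have hxz : |x - z| ≤ ε := by
      rw [abs_of_pos (by linarith [hx.1])]
      linarith [hx.2]
    have hA : 0 ≤ A := (abs_nonneg _).trans hp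
    have hM : 0 ≤ M := (abs_nonneg _).trans hu
    have hC0 : 0 ≤ C := (abs_nonneg _).trans hd
    have hvε : |v - v'| ≤ L * ε := hv.trans (mul_le_mul_of_nonneg_left hxz hL)
    rw [abs_mul]
    refine mul_le_mul hu ((abs_add_le _ _).trans ?_) (abs_nonneg _) hM
    refine add_le_add ?_ ?_
    · rw [abs_mul]
      simpa using mul_le_mul hp' hj (abs_nonneg _) hA
    · rw [abs_mul, abs_mul, abs_mul, abs_of_pos (one_div_pos.2 hε)]
      refine mul_le_mul hp ?_ (by positivity) hA
      calc |deriv Real.smoothTransition ((x - z) / ε)| * (1 / ε) * |v - v'|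
          ≤ C * (1 / ε) * (L * ε) := by gcongr
        _ = C * L := by field_simp
  · have hx' : (x - z) / ε ∉ Ioc (0:ℝ) 1 := fun h => by
      refine hx ⟨?_, ?_⟩
      · have := (div_pos_iff_of_pos_right hε).1 h.1
        linarith
      · have := (div_le_one hε).1 h.2
        linarith
    rw [indicator_of_notMem hx] at hj ⊢
    rw [indicator_of_notMem hx'] at hd
    rw [abs_nonpos_iff.1 hj, abs_nonpos_iff.1 hd]
    simp

/-- A cut-off moving along two curves is an admissible test function. -/
lemma isTestFun_moving_cutoff {T : ℝ} {ψ X Y : ℝ → ℝ} (hψ : ContDiff ℝ 1 ψ)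
    (hψc : HasCompactSupport ψ) (hψT : ∀ t, T ≤ t → ψ t = 0) (hX : ContDiff ℝ 1 X)
    (hY : ContDiff ℝ 1 Y) {ε : ℝ} (hε : 0 < ε) :
    IsTestFun T fun t x => ψ t * (Real.smoothTransition ((x - X t) / ε) -
      Real.smoothTransition ((x - Y t) / ε)) := by
  refine ⟨?_, ?_, fun t x ht => by simp [hψT t ht]⟩
  · have h : ∀ Z : ℝ → ℝ, ContDiff ℝ 1 Z →
        ContDiff ℝ 1 fun p : ℝ × ℝ => Real.smoothTransition ((p.2 - Z p.1) / ε) := fun Z hZ =>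
      Real.smoothTransition.contDiff.comp
        ((contDiff_snd.sub (hZ.comp contDiff_fst)).div_const ε)
    exact (hψ.comp contDiff_fst).mul ((h X hX).sub (h Y hY))
  · obtain ⟨R₁, hR₁⟩ := hψc.isCompact.exists_bound_of_continuousOn hX.continuous.continuousOn
    obtain ⟨R₂, hR₂⟩ := hψc.isCompact.exists_bound_of_continuousOn hY.continuous.continuousOn
    set R := max R₁ R₂ with hR
    refine HasCompactSupport.intro (hψc.isCompact.prod (isCompact_Icc (a := -R) (b := R + ε)))
      fun p hp => ?_
    obtain ⟨t, x⟩ := p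
    simp only [uncurry_apply_pair]
    by_cases ht : t ∈ tsupport ψ
    · have h1 := abs_le.1 ((hR₁ t ht).trans (le_max_left R₁ R₂))
      have h2 := abs_le.1 ((hR₂ t ht).trans (le_max_right R₁ R₂))
      rcases lt_or_ge x (-R) with hx | hx
      · rw [Real.smoothTransition.zero_of_nonpos
            (div_nonpos_of_nonpos_of_nonneg (by linarith [h1.1]) hε.le),
          Real.smoothTransition.zero_of_nonpos
            (div_nonpos_of_nonpos_of_nonneg (by linarith [h2.1]) hε.le)]
        simp
      · have hx' : R + ε < x := by
          by_contra h
          exact hp ⟨ht, hx, not_lt.1 h⟩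
        rw [Real.smoothTransition.one_of_one_le ((one_le_div hε).2 (by linarith [h1.2])),
          Real.smoothTransition.one_of_one_le ((one_le_div hε).2 (by linarith [h2.2]))]
        simp
    · rw [image_eq_zero_of_notMem_tsupport ht, zero_mul]

/-- Mass between two characteristics is conserved by weak solutions of the continuity equation
with a continuous, spatially Lipschitz velocity. -/
lemma integral_between_characteristics_eq {T : ℝ} (hT : 0 < T) {b : ℝ → ℝ → ℝ}
    (hb : Continuous (uncurry b)) {L : NNReal} (hL : ∀ t, LipschitzWith L (b t))
    {q : ℝ → ℝ → ℝ} {q₀ : ℝ → ℝ} (hq : InSolutionClass T q) (hq₀ : Measurable q₀) {M : ℝ}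
    (hM : ∀ t x, |q t x| ≤ M) (hM₀ : ∀ x, |q₀ x| ≤ M)
    (hsol : ∀ φ : ℝ → ℝ → ℝ, IsTestFun T φ →
      (∫ t in Ioo (0:ℝ) T, ∫ x : ℝ, q t x *
        (deriv (fun s => φ s x) t + deriv (fun y => φ t y) x * b t x))
      + (∫ x : ℝ, φ 0 x * q₀ x) = 0)
    {X Y : ℝ → ℝ} (hX : ContDiff ℝ 1 X) (hY : ContDiff ℝ 1 Y)
    (hX' : ∀ t ∈ Icc (0:ℝ) T, HasDerivAt X (b t (X t)) t)
    (hY' : ∀ t ∈ Icc (0:ℝ) T, HasDerivAt Y (b t (Y t)) t) :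
    ∀ t ∈ Icc (0:ℝ) T, ∫ x in X t..Y t, q t x = ∫ x in X 0..Y 0, q₀ x := by
  have hF := continuousOn_integral_moving hq hX.continuous hY.continuous
  refine eqOn_const_of_weak_deriv_eq_zero hT hF fun ψ hψ hψc hψT => ?_
  set F : ℝ → ℝ := fun t => ∫ x in X t..Y t, q t x with hFdef
  set c := ∫ x in X 0..Y 0, q₀ x with hcdef
  have hqt : ∀ t, Measurable (q t) := fun t => hq.meas.comp measurable_prodMk_left
  have hM0 : 0 ≤ M := (abs_nonneg _).trans (hM₀ 0)
  obtain ⟨C, hC0, hC⟩ := exists_bound_deriv_smoothTransition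
  obtain ⟨A₁, hA₁⟩ := hψc.exists_bound_of_continuous hψ.continuous
  obtain ⟨A₂, hA₂⟩ := hψc.deriv.exists_bound_of_continuous (hψ.continuous_deriv le_rfl)
  set A := max A₁ A₂ with hA
  have hψA : ∀ t, |ψ t| ≤ A := fun t => (hA₁ t).trans (le_max_left _ _)
  have hψA' : ∀ t, |deriv ψ t| ≤ A := fun t => (hA₂ t).trans (le_max_right _ _)
  have hA0 : 0 ≤ A := (abs_nonneg _).trans (hψA 0)
  set K := M * (A + A * (C * L)) with hK
  set E := (∫ t in Ioo 0 T, deriv ψ t * F t) + ψ 0 * c with hE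
  have hψF : IntegrableOn (fun t => deriv ψ t * F t) (Ioo 0 T) :=
    (((hψ.continuous_deriv le_rfl).continuousOn.mul hF).integrableOn_Icc).mono_set
      Ioo_subset_Icc_self
  have hHc : Continuous Real.smoothTransition := Real.smoothTransition.continuous
  have hHc' : Continuous (deriv Real.smoothTransition) :=
    (Real.smoothTransition.contDiff (n := 1)).continuous_deriv le_rfl
  have hHd : ∀ x, HasDerivAt Real.smoothTransition (deriv Real.smoothTransition x) x := fun x =>
    ((Real.smoothTransition.contDiff (n := 1)).differentiable one_ne_zero x).hasDerivAt
  have hbound : ∀ ε > 0, |E| ≤ (2 * K * T + A * (2 * M)) * ε := by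
    intro ε hε
    have hsolε := hsol _ (isTestFun_moving_cutoff hψ hψc hψT hX hY hε)
    have hdt : ∀ t x, deriv (fun s => ψ s * (Real.smoothTransition ((x - X s) / ε) -
        Real.smoothTransition ((x - Y s) / ε))) t =
        deriv ψ t * (Real.smoothTransition ((x - X t) / ε) -
          Real.smoothTransition ((x - Y t) / ε)) +
        ψ t * (deriv Real.smoothTransition ((x - X t) / ε) * (-deriv X t / ε) -
          deriv Real.smoothTransition ((x - Y t) / ε) * (-deriv Y t / ε)) := by
      intro t x
      have h : ∀ Z : ℝ → ℝ, ContDiff ℝ 1 Z →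
          HasDerivAt (fun s => Real.smoothTransition ((x - Z s) / ε))
            (deriv Real.smoothTransition ((x - Z t) / ε) * (-deriv Z t / ε)) t := fun Z hZ =>
        (hHd _).comp t
          ((((hZ.differentiable one_ne_zero t).hasDerivAt).const_sub x).div_const ε)
      exact (((hψ.differentiable one_ne_zero t).hasDerivAt).mul ((h X hX).sub (h Y hY))).deriv
    have hdx : ∀ t x, deriv (fun y => ψ t * (Real.smoothTransition ((y - X t) / ε) -
        Real.smoothTransition ((y - Y t) / ε))) x =
        ψ t * (deriv Real.smoothTransition ((x - X t) / ε) * (1 / ε) -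
          deriv Real.smoothTransition ((x - Y t) / ε) * (1 / ε)) := by
      intro t x
      have h : ∀ z : ℝ, HasDerivAt (fun y => Real.smoothTransition ((y - z) / ε))
            (deriv Real.smoothTransition ((x - z) / ε) * (1 / ε)) x := fun z =>
        (hHd _).comp x (((hasDerivAt_id x).sub_const z).div_const ε)
      exact (((h (X t)).sub (h (Y t))).const_mul (ψ t)).deriv
    simp only [hdt, hdx] at hsolε
    set J : ℝ → ℝ → ℝ := fun t x => q t x *
      (deriv ψ t * (Real.smoothTransition ((x - X t) / ε) -
          Real.smoothTransition ((x - Y t) / ε)) +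
        ψ t * (deriv Real.smoothTransition ((x - X t) / ε) * (-deriv X t / ε) -
          deriv Real.smoothTransition ((x - Y t) / ε) * (-deriv Y t / ε)) +
        ψ t * (deriv Real.smoothTransition ((x - X t) / ε) * (1 / ε) -
          deriv Real.smoothTransition ((x - Y t) / ε) * (1 / ε)) * b t x) with hJ
    have hJm : Measurable (uncurry J) := by
      have hXc := hX.continuous
      have hYc := hY.continuous
      have hXd := hX.continuous_deriv le_rfl
      have hYd := hY.continuous_deriv le_rfl
      have hψ0 := hψ.continuous
      have hψd := hψ.continuous_deriv le_rfl
      have hb' : Continuous fun p : ℝ × ℝ => b p.1 p.2 := hb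
      refine hq.meas.mul (Continuous.measurable ?_)
      fun_prop
    have hJt : ∀ t, Measurable (J t) := fun t => hJm.comp measurable_prodMk_left
    have hlayer : ∀ t ∈ Icc (0:ℝ) T, |(∫ x, J t x) - deriv ψ t * F t| ≤ 2 * K * ε := by
      intro t ht
      obtain ⟨hSi, hSv⟩ := integral_mul_indicator_Ioi_sub (hqt t) (hM t) (X t) (Y t)
      set s : ℝ → ℝ := fun x => q t x * ((Ioi (X t)).indicator (fun _ => (1:ℝ)) x -
        (Ioi (Y t)).indicator (fun _ => (1:ℝ)) x) with hs
      have hsm : Measurable s := (hqt t).mul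
        ((measurable_const.indicator measurableSet_Ioi).sub
          (measurable_const.indicator measurableSet_Ioi))
      obtain ⟨hDi, hDv⟩ := integrable_and_abs_integral_le_of_two_intervals
        (g := fun x => J t x - deriv ψ t * s x) (a := X t) (c := Y t) (C := K)
        ((hJt t).sub (hsm.const_mul _)) hε (fun x => by
          have hl : ∀ z, |b t x - b t z| ≤ L * |x - z| := fun z => by
            simpa [Real.dist_eq] using (hL t).dist_le_mul x z
          have h1 := boundary_layer_bound hC hε L.2 (hM t x) (hψA t) (hψA' t) (hl (X t))
          have h2 := boundary_layer_bound hC hε L.2 (hM t x) (hψA t) (hψA' t) (hl (Y t))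
          refine le_trans (le_of_eq ?_) ((abs_sub _ _).trans (add_le_add h1 h2))
          congr 1
          simp only [hJ, hs, (hX' t ht).deriv, (hY' t ht).deriv]
          ring)
      have hJi : Integrable (J t) := by
        have := hDi.add (hSi.const_mul (deriv ψ t))
        refine this.congr (ae_of_all _ fun x => ?_)
        simp [hs]
      rw [integral_sub hJi (hSi.const_mul _), integral_const_mul, hSv] at hDv
      exact hDv
    have hJint : IntegrableOn (fun t => ∫ x, J t x) (Ioo 0 T) := by
      have hm : StronglyMeasurable fun t => ∫ x, J t x :=
        hJm.stronglyMeasurable.integral_prod_right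
      have hdiff : IntegrableOn (fun t => (∫ x, J t x) - deriv ψ t * F t) (Ioo 0 T) := by
        refine Integrable.of_bound (hm.aestronglyMeasurable.sub hψF.aestronglyMeasurable)
          (2 * K * ε) ?_
        exact (ae_restrict_iff' measurableSet_Ioo).2
          (ae_of_all _ fun t ht => hlayer t (Ioo_subset_Icc_self ht))
      refine (hdiff.add hψF).congr (ae_of_all _ fun t => ?_)
      simp
    have h1 : |(∫ t in Ioo 0 T, ∫ x, J t x) - ∫ t in Ioo 0 T, deriv ψ t * F t| ≤
        2 * K * ε * T := by
      rw [← integral_sub hJint hψF]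
      have := norm_setIntegral_le_of_norm_le_const (μ := volume) (s := Ioo 0 T)
        (f := fun t => (∫ x, J t x) - deriv ψ t * F t) (C := 2 * K * ε) (by simp)
        (fun t ht => hlayer t (Ioo_subset_Icc_self ht))
      simpa [hT.le] using this
    have h2 : |(∫ x, ψ 0 * (Real.smoothTransition ((x - X 0) / ε) -
        Real.smoothTransition ((x - Y 0) / ε)) * q₀ x) - ψ 0 * c| ≤ A * (2 * M) * ε := by
      obtain ⟨hSi, hSv⟩ := integral_mul_indicator_Ioi_sub hq₀ hM₀ (X 0) (Y 0)
      set s : ℝ → ℝ := fun x => q₀ x * ((Ioi (X 0)).indicator (fun _ => (1:ℝ)) x -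
        (Ioi (Y 0)).indicator (fun _ => (1:ℝ)) x) with hs
      have hsm : Measurable s := hq₀.mul
        ((measurable_const.indicator measurableSet_Ioi).sub
          (measurable_const.indicator measurableSet_Ioi))
      set g : ℝ → ℝ := fun x => ψ 0 * (Real.smoothTransition ((x - X 0) / ε) -
        Real.smoothTransition ((x - Y 0) / ε)) * q₀ x with hg
      have hgm : Measurable g := by
        refine Measurable.mul (Continuous.measurable ?_) hq₀
        fun_prop
      obtain ⟨hDi, hDv⟩ := integrable_and_abs_integral_le_of_two_intervals
        (g := fun x => g x - ψ 0 * s x) (a := X 0) (c := Y 0) (C := M * (A + A * (C * 0)))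
        (hgm.sub (hsm.const_mul _)) hε (fun x => by
          have h1 := boundary_layer_bound (z := X 0) (v := 0) (v' := 0) (x := x) hC hε le_rfl (hM₀ x)
            (hψA 0) (hψA 0) (by simp)
          have h2 := boundary_layer_bound (z := Y 0) (v := 0) (v' := 0) (x := x) hC hε le_rfl (hM₀ x)
            (hψA 0) (hψA 0) (by simp)
          refine le_trans (le_of_eq ?_) ((abs_sub _ _).trans (add_le_add h1 h2))
          congr 1
          simp only [hg, hs]
          ring)
      have hgi : Integrable g := by
        have := hDi.add (hSi.const_mul (ψ 0))
        refine this.congr (ae_of_all _ fun x => ?_)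
        simp [hs]
      rw [integral_sub hgi (hSi.const_mul _), integral_const_mul, hSv] at hDv
      refine hDv.trans (le_of_eq ?_)
      ring
    rw [abs_le] at h1 h2 ⊢
    constructor <;> linarith [h1.1, h1.2, h2.1, h2.2]
  have hlim : Tendsto (fun ε : ℝ => (2 * K * T + A * (2 * M)) * ε) (nhdsWithin 0 (Ioi 0))
      (nhds 0) := by
    have : Continuous fun ε : ℝ => (2 * K * T + A * (2 * M)) * ε := by fun_prop
    simpa using (this.tendsto 0).mono_left nhdsWithin_le_nhds
  have hE0 : |E| ≤ 0 := ge_of_tendsto hlim (eventually_nhdsWithin_of_forall hbound)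
  exact abs_nonpos_iff.1 hE0

lemma AdmissibleKernel.integrableOn {γ : ℝ → ℝ} (hγ : AdmissibleKernel γ) :
    IntegrableOn γ (Iic 0) := by
  by_contra h
  have := hγ.mass
  rw [integral_undef h] at this
  exact zero_ne_one this

/-- The left limit of an admissible kernel at the origin. -/
lemma AdmissibleKernel.exists_leftLim {γ : ℝ → ℝ} (hγ : AdmissibleKernel γ) :
    ∃ G : ℝ, (∀ x < 0, γ x ≤ G) ∧ Tendsto γ (nhdsWithin 0 (Iio 0)) (nhds G) := by
  have hbdd : BddAbove (γ '' Iio 0) := by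
    refine ⟨γ 0, ?_⟩
    rintro _ ⟨x, hx, rfl⟩
    have hx' : x ≤ 0 := le_of_lt (mem_Iio.1 hx)
    exact hγ.mono (mem_Iic.2 hx') (by simp) hx'
  exact ⟨sSup (γ '' Iio 0), fun x hx => le_csSup hbdd (mem_image_of_mem _ hx),
    (hγ.mono.mono Iio_subset_Iic_self).tendsto_nhdsLT hbdd⟩

/-- The nonlocal term takes values between `0` and any bound of the density. -/
lemma nonlocalTerm_mem_Icc {γ : ℝ → ℝ} (hγ : AdmissibleKernel γ) {q : ℝ → ℝ → ℝ} {t M : ℝ}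
    (hqt : Measurable (q t)) (hM : ∀ x, |q t x| ≤ M) (x : ℝ) :
    nonlocalTerm γ q t x ∈ Icc 0 M := by
  have hki : Integrable ((Iic (0:ℝ)).indicator γ) :=
    (integrable_indicator_iff measurableSet_Iic).2 hγ.integrableOn
  have hk0 : ∀ y, 0 ≤ (Iic (0:ℝ)).indicator γ y := indicator_nonneg hγ.nonneg
  rw [nonlocalTerm, setIntegral_kernel_eq γ fun y => |q t y|]
  constructor
  · exact integral_nonneg fun y => mul_nonneg (hk0 _) (abs_nonneg _)
  · have hv : ∫ y, (Iic (0:ℝ)).indicator γ (y - x) * M = M := by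
      rw [integral_mul_const, integral_sub_right_eq_self, integral_indicator measurableSet_Iic,
        hγ.mass, one_mul]
    conv_rhs => rw [← hv]
    refine integral_mono (integrable_comp_sub_mul hki hqt.abs
      (ae_of_all _ fun y => by rw [abs_abs]; exact hM y) x)
      ((hki.comp_sub_right x).mul_const M) fun y => ?_
    exact mul_le_mul_of_nonneg_left (hM y) (hk0 _)

/-- The velocity field `V(W[q,γ])` agrees on `[0,T]` with a globally continuous, bounded and
spatially Lipschitz field. -/
lemma exists_velocity_extension {T : ℝ} (hT : 0 < T) {V : ℝ → ℝ} (hV : LocallyLipschitz V)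
    (hVmono : Monotone V) {γ : ℝ → ℝ} (hγ : AdmissibleKernel γ) {q : ℝ → ℝ → ℝ}
    (hq : InSolutionClass T q) :
    ∃ (b : ℝ → ℝ → ℝ) (L B : NNReal), Continuous (uncurry b) ∧ (∀ t, LipschitzWith L (b t)) ∧
      (∀ t x, |b t x| ≤ B) ∧
      ∀ t ∈ Icc (0:ℝ) T, ∀ x, b t x = V (nonlocalTerm γ q t x) := by
  obtain ⟨M, hM⟩ := hq.bdd
  have hM0 : 0 ≤ M := (abs_nonneg _).trans (hM 0 0)
  have hqt : ∀ t, Measurable (q t) := fun t => hq.meas.comp measurable_prodMk_left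
  obtain ⟨G, hG, -⟩ := hγ.exists_leftLim
  have hG0 : 0 ≤ G := (hγ.nonneg (-1) (by norm_num)).trans (hG (-1) (by norm_num))
  have hmem : ∀ t x, nonlocalTerm γ q t x ∈ Icc 0 M := fun t x =>
    nonlocalTerm_mem_Icc hγ (hqt t) (hM t) x
  obtain ⟨K, hK⟩ := (hV.locallyLipschitzOn (s := Icc 0 M)).exists_lipschitzOnWith_of_compact
    isCompact_Icc
  have hWle : ∀ t x y, x ≤ y →
      |nonlocalTerm γ q t y - nonlocalTerm γ q t x| ≤ M * G * (y - x) := by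
    intro t x y hxy
    obtain ⟨h1, h2⟩ := kernel_increment_bounds hγ.mono hγ.nonneg hγ.integrableOn hG (hqt t).abs
      (fun y => abs_nonneg _) (ae_of_all _ (hM t)) hxy
    have h3 : 0 ≤ γ (x - y) * ∫ z in x..y, |q t z| :=
      mul_nonneg (hγ.nonneg _ (by linarith))
        (intervalIntegral.integral_nonneg hxy fun _ _ => abs_nonneg _)
    rw [abs_le]
    constructor <;> simp only [nonlocalTerm] <;> linarith
  have hWL : ∀ t, LipschitzWith (⟨M * G, mul_nonneg hM0 hG0⟩ : NNReal) (nonlocalTerm γ q t) :=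
    fun t => LipschitzWith.of_dist_le_mul fun x y => by
      rw [Real.dist_eq, Real.dist_eq]
      rcases le_total x y with h | h
      · rw [abs_sub_comm, abs_sub_comm x y, abs_of_nonneg (sub_nonneg.2 h)]
        exact hWle t x y h
      · rw [abs_of_nonneg (sub_nonneg.2 h)]
        exact hWle t y x h
  have hbL : ∀ t : ℝ, LipschitzWith (K * ⟨M * G, mul_nonneg hM0 hG0⟩)
      fun x => V (nonlocalTerm γ q (projIcc 0 T hT.le t) x) := fun t =>
    lipschitzOnWith_univ.1
      (hK.comp (lipschitzOnWith_univ.2 (hWL _)) fun x _ => hmem _ x)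
  refine ⟨fun t x => V (nonlocalTerm γ q (projIcc 0 T hT.le t) x), _, ⟨max |V 0| |V M|,
    le_max_of_le_left (abs_nonneg _)⟩, ?_, hbL, fun t x => ?_, fun t ht x => ?_⟩
  · refine continuous_prod_of_continuous_lipschitzWith' _ _ hbL fun x => ?_
    have := (continuousOn_nonlocalTerm hγ hγ.integrableOn hq x).domRestrict.comp
      (continuous_projIcc (h := hT.le))
    exact hV.continuous.comp this
  · exact abs_le_max_abs_abs (hVmono (hmem _ x).1) (hVmono (hmem _ x).2)
  · simp only [projIcc_of_mem hT.le ht]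

/-- A one-sided Grönwall estimate from below. -/
lemma sub_le_mul_exp_of_deriv_ge {d d' : ℝ → ℝ} {r t a e : ℝ} (hrt : r ≤ t) (ha : 0 ≤ a)
    (he : 0 ≤ e) (hd : ∀ s ∈ Icc r t, HasDerivAt d (d' s) s)
    (h : ∀ s ∈ Icc r t, -a * d s - e ≤ d' s) :
    d r - e * Real.exp (a * (t - r)) * (t - r) ≤ d t * Real.exp (a * (t - r)) := by
  set g : ℝ → ℝ := fun s =>
    d s * Real.exp (a * (s - r)) + e * Real.exp (a * (t - r)) * (s - r) with hg
  have hgd : ∀ s ∈ Icc r t, HasDerivAt g ((d' s + a * d s) * Real.exp (a * (s - r)) +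
      e * Real.exp (a * (t - r))) s := by
    intro s hs
    have h1 : HasDerivAt (fun s => Real.exp (a * (s - r))) (Real.exp (a * (s - r)) * (a * 1)) s :=
      (((hasDerivAt_id s).sub_const r).const_mul a).exp
    have h2 : HasDerivAt (fun s => e * Real.exp (a * (t - r)) * (s - r))
        (e * Real.exp (a * (t - r)) * 1) s := ((hasDerivAt_id s).sub_const r).const_mul _
    refine (((hd s hs).mul h1).add h2).congr_deriv ?_
    ring
  have hmono : MonotoneOn g (Icc r t) := by
    refine monotoneOn_of_deriv_nonneg (convex_Icc r t)
      (fun s hs => (hgd s hs).continuousAt.continuousWithinAt)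
      (fun s hs => (hgd s (interior_subset hs)).differentiableAt.differentiableWithinAt)
      fun s hs => ?_
    have hs' := interior_subset hs
    rw [(hgd s hs').deriv]
    have h1 : Real.exp (a * (s - r)) ≤ Real.exp (a * (t - r)) :=
      Real.exp_le_exp.2 (mul_le_mul_of_nonneg_left (by linarith [hs'.2]) ha)
    have h2 := h s hs'
    nlinarith [Real.exp_pos (a * (s - r)), mul_le_mul_of_nonneg_left h1 he,
      mul_le_mul_of_nonneg_right (show -e ≤ d' s + a * d s by linarith)
        (Real.exp_pos (a * (s - r))).le]
  have := hmono (left_mem_Icc.2 hrt) (right_mem_Icc.2 hrt) hrt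
  simp only [hg, sub_self, mul_zero, Real.exp_zero, mul_one, add_zero] at this
  linarith

/-- Two integral curves of a Lipschitz field that are ordered at time `t` are ordered before. -/
lemma characteristics_ordered {b : ℝ → ℝ → ℝ} {L : NNReal} (hL : ∀ t, LipschitzWith L (b t))
    {X Y : ℝ → ℝ} {t : ℝ} (hX : ∀ s ∈ Icc 0 t, HasDerivAt X (b s (X s)) s)
    (hY : ∀ s ∈ Icc 0 t, HasDerivAt Y (b s (Y s)) s) (hXY : X t < Y t) :
    ∀ s ∈ Icc 0 t, X s < Y s := by
  have hXc : ContinuousOn X (Icc 0 t) := fun s hs => (hX s hs).continuousAt.continuousWithinAt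
  have hYc : ContinuousOn Y (Icc 0 t) := fun s hs => (hY s hs).continuousAt.continuousWithinAt
  intro s hs
  by_contra hcon
  have hsub : Icc s t ⊆ Icc 0 t := Icc_subset_Icc_left hs.1
  obtain ⟨r, hr, hr0⟩ := intermediate_value_Icc hs.2 ((hYc.sub hXc).mono hsub)
    (show (0:ℝ) ∈ Icc ((Y - X) s) ((Y - X) t) from
      ⟨by simpa using not_lt.1 hcon, by simpa using hXY.le⟩)
  have hsub' : Icc r t ⊆ Icc 0 t := Icc_subset_Icc_left (hs.1.trans hr.1)
  have hXY0 : Y r = X r := sub_eq_zero.1 hr0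
  have := dist_le_of_trajectories_ODE (δ := 0) hL (hXc.mono hsub')
    (fun u hu => (hX u (hsub' (Ico_subset_Icc_self hu))).hasDerivWithinAt) (hYc.mono hsub')
    (fun u hu => (hY u (hsub' (Ico_subset_Icc_self hu))).hasDerivWithinAt)
    (by rw [hXY0, dist_self]) t (right_mem_Icc.2 hr.2)
  rw [zero_mul, dist_le_zero] at this
  exact hXY.ne this

/-- The distance of two ordered integral curves of a Lipschitz field is comparable with its
values at the endpoints of the time interval. -/
lemma characteristics_gap_le {b : ℝ → ℝ → ℝ} {L : NNReal} (hL : ∀ t, LipschitzWith L (b t))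
    {X Y : ℝ → ℝ} {t T : ℝ} (htT : t ≤ T) (hX : ∀ s ∈ Icc 0 t, HasDerivAt X (b s (X s)) s)
    (hY : ∀ s ∈ Icc 0 t, HasDerivAt Y (b s (Y s)) s) (hXY : ∀ s ∈ Icc 0 t, X s < Y s) :
    ∀ s ∈ Icc 0 t, Y s - X s ≤ Real.exp (L * T) * (Y 0 - X 0) ∧
      Y s - X s ≤ Real.exp (L * T) * (Y t - X t) := by
  intro s hs
  have h0 : (0:ℝ) ∈ Icc 0 t := ⟨le_rfl, hs.1.trans hs.2⟩
  have ht : t ∈ Icc 0 t := ⟨hs.1.trans hs.2, le_rfl⟩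
  constructor
  · have hXc : ContinuousOn X (Icc 0 t) := fun s hs => (hX s hs).continuousAt.continuousWithinAt
    have hYc : ContinuousOn Y (Icc 0 t) := fun s hs => (hY s hs).continuousAt.continuousWithinAt
    have h := dist_le_of_trajectories_ODE hL hYc
      (fun u hu => (hY u (Ico_subset_Icc_self hu)).hasDerivWithinAt) hXc
      (fun u hu => (hX u (Ico_subset_Icc_self hu)).hasDerivWithinAt) le_rfl s hs
    rw [Real.dist_eq, Real.dist_eq, abs_of_pos (sub_pos.2 (hXY s hs)),
      abs_of_pos (sub_pos.2 (hXY 0 h0)), sub_zero, mul_comm] at h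
    refine h.trans (mul_le_mul_of_nonneg_right (Real.exp_le_exp.2 ?_) (sub_pos.2 (hXY 0 h0)).le)
    exact mul_le_mul_of_nonneg_left (hs.2.trans htT) L.2
  · have hsub : Icc s t ⊆ Icc 0 t := Icc_subset_Icc_left hs.1
    have h := sub_le_mul_exp_of_deriv_ge (d := fun u => Y u - X u) hs.2 L.2 le_rfl
      (fun u hu => (hY u (hsub hu)).sub (hX u (hsub hu))) fun u hu => by
        have h1 := (hL u).dist_le_mul (Y u) (X u)
        rw [Real.dist_eq, Real.dist_eq, abs_of_pos (sub_pos.2 (hXY u (hsub hu)))] at h1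
        have h2 := (abs_le.1 h1).1
        change -(L:ℝ) * (Y u - X u) - 0 ≤ _
        linarith
    simp only [zero_mul, sub_zero] at h
    rw [mul_comm] at h
    refine h.trans (mul_le_mul_of_nonneg_right (Real.exp_le_exp.2 ?_) (sub_pos.2 (hXY t ht)).le)
    exact mul_le_mul_of_nonneg_left (by linarith [hs.1]) L.2

/-- A conserved mass `I` carried by an interval of length `d` has density bounded away from `S`
if `d` shrinks at a rate essentially proportional to the defect `S * d - I`. -/
lemma mass_le_of_gap_deriv_ge {d d' : ℝ → ℝ} {t T K G S ε I m N : ℝ} (ht : t ∈ Icc 0 T)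
    (hK : 0 ≤ K) (hG : 0 ≤ G) (hS : 0 ≤ S) (hε : 0 ≤ ε) (hN : 1 ≤ N) (hm : m ≤ S)
    (hd : ∀ s ∈ Icc 0 t, HasDerivAt d (d' s) s)
    (hdN : ∀ s ∈ Icc 0 t, d s ≤ N * d 0) (hd0 : 0 ≤ d 0)
    (hd' : ∀ s ∈ Icc 0 t, -(K * (G * (S * d s - I) + ε * S * d s)) ≤ d' s)
    (hI : I ≤ m * d 0) (hIS : I ≤ S * d t)
    (hεS : ε * (S ^ 2 * K * N * Real.exp (S * K * G * T) * T) ≤ (S - m) / 2) :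
    I ≤ (S - (S - m) / (2 * N * Real.exp (S * K * G * T))) * d t := by
  have ht' : t ∈ Icc 0 t := ⟨ht.1, le_rfl⟩
  have hT : 0 ≤ T := ht.1.trans ht.2
  have ha : 0 ≤ S * K * G := by positivity
  have he : 0 ≤ S * K * (ε * S * (N * d 0)) := by positivity
  have h := sub_le_mul_exp_of_deriv_ge (d := fun s => S * d s - I) (e := S * K * (ε * S * (N * d 0)))
    ht.1 ha he (fun s hs => ((hd s hs).const_mul S).sub_const I) fun s hs => by
      have h1 := mul_le_mul_of_nonneg_left (hd' s hs) hS
      have h2 : S * K * (ε * S * d s) ≤ S * K * (ε * S * (N * d 0)) :=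
        mul_le_mul_of_nonneg_left (mul_le_mul_of_nonneg_left (hdN s hs) (by positivity))
          (by positivity)
      change -(S * K * G) * (S * d s - I) - _ ≤ S * d' s
      linarith
  simp only [sub_zero] at h
  set E := Real.exp (S * K * G * T) with hE
  have hEt : Real.exp (S * K * G * t) ≤ E :=
    Real.exp_le_exp.2 (mul_le_mul_of_nonneg_left ht.2 ha)
  have hEpos : 0 < E := Real.exp_pos _
  have h1 : (S * d t - I) * Real.exp (S * K * G * t) ≤ (S * d t - I) * E :=
    mul_le_mul_of_nonneg_left hEt (sub_nonneg.2 hIS)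
  have h2 : S * K * (ε * S * (N * d 0)) * Real.exp (S * K * G * t) * t ≤
      S * K * (ε * S * (N * d 0)) * E * T := by
    have := ht.1
    have := ht.2
    gcongr
  have h3 := mul_le_mul_of_nonneg_right hεS hd0
  have h4 : (S - m) / 2 * d 0 ≤ (S * d t - I) * E := by nlinarith
  have h5 : (S - m) * d t ≤ (S - m) * (N * d 0) :=
    mul_le_mul_of_nonneg_left (hdN t ht') (sub_nonneg.2 hm)
  have h6 : (S - m) / (2 * N * E) * d t ≤ S * d t - I := by
    rw [div_mul_eq_mul_div, div_le_iff₀ (by positivity)]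
    nlinarith [mul_le_mul_of_nonneg_left h4 (show 0 ≤ 2 * N by linarith)]
  linarith

/-- The integral over an interval of a function bounded almost everywhere. -/
lemma abs_intervalIntegral_le_of_ae {f : ℝ → ℝ} {S a b : ℝ} (hf : ∀ᵐ x, |f x| ≤ S)
    (hab : a ≤ b) : |∫ x in a..b, f x| ≤ S * (b - a) := by
  have := intervalIntegral.norm_integral_le_of_norm_le_const_ae (a := a) (b := b) (f := f) (C := S)
    (hf.mono fun x hx _ => hx)
  rwa [Real.norm_eq_abs, abs_of_nonneg (sub_nonneg.2 hab)] at this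

/-- Any uniform bound of a weak solution exceeding the bound `m` of the initial datum can be
strictly improved. -/
lemma exists_improved_bound {T : ℝ} (hT : 0 < T) {V : ℝ → ℝ} (hV : LocallyLipschitz V)
    (hVmono : Monotone V) {q₀ : ℝ → ℝ} (hq₀ : Measurable q₀) (hq₀bdd : ∃ M : ℝ, ∀ x, |q₀ x| ≤ M)
    {γ : ℝ → ℝ} (hγ : AdmissibleKernel γ) {q : ℝ → ℝ → ℝ} (hq : InSolutionClass T q)
    (hsol : IsWeakSolutionNonlocal T V γ q₀ q) {m S : ℝ} (hm : 0 ≤ m) (hmS : m < S)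
    (hqm : ∀ᵐ x, |q₀ x| ≤ m) (hqS : ∀ t ∈ Icc (0:ℝ) T, ∀ᵐ x, |q t x| ≤ S) :
    ∃ κ > 0, ∀ t ∈ Icc (0:ℝ) T, ∀ᵐ x, |q t x| ≤ S - κ := by
  obtain ⟨M₁, hM₁⟩ := hq.bdd
  obtain ⟨M₂, hM₂⟩ := hq₀bdd
  have hM : ∀ t x, |q t x| ≤ max M₁ M₂ := fun t x => (hM₁ t x).trans (le_max_left _ _)
  have hM₀ : ∀ x, |q₀ x| ≤ max M₁ M₂ := fun x => (hM₂ x).trans (le_max_right _ _)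
  have hqt : ∀ t, Measurable (q t) := fun t => hq.meas.comp measurable_prodMk_left
  have hloc : ∀ t, LocallyIntegrable (q t) volume := fun t =>
    (locallyIntegrable_const (max M₁ M₂)).mono (hqt t).aestronglyMeasurable
      (ae_of_all _ fun x => (hM t x).trans (le_abs_self _))
  obtain ⟨G, hG, hGlim⟩ := hγ.exists_leftLim
  have hG0 : 0 ≤ G := (hγ.nonneg (-1) (by norm_num)).trans (hG (-1) (by norm_num))
  have hmem : ∀ t x, nonlocalTerm γ q t x ∈ Icc 0 M₁ := fun t x =>
    nonlocalTerm_mem_Icc hγ (hqt t) (hM₁ t) x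
  obtain ⟨K, hK⟩ := (hV.locallyLipschitzOn (s := Icc 0 M₁)).exists_lipschitzOnWith_of_compact
    isCompact_Icc
  obtain ⟨b, L, B, hbc, hbL, hbB, hbV⟩ := exists_velocity_extension hT hV hVmono hγ hq
  have hsolb : ∀ φ : ℝ → ℝ → ℝ, IsTestFun T φ →
      (∫ t in Ioo (0:ℝ) T, ∫ x : ℝ, q t x *
        (deriv (fun s => φ s x) t + deriv (fun y => φ t y) x * b t x))
      + (∫ x : ℝ, φ 0 x * q₀ x) = 0 := by
    intro φ hφ
    refine Eq.trans ?_ (hsol φ hφ)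
    congr 1
    refine setIntegral_congr_fun measurableSet_Ioo fun t ht => ?_
    simp only [hbV t (Ioo_subset_Icc_self ht)]
  have hS : 0 < S := hm.trans_lt hmS
  have hN : 1 ≤ Real.exp (L * T) := Real.one_le_exp (mul_nonneg L.2 hT.le)
  set N := Real.exp (L * T) with hNdef
  set C := S ^ 2 * K * N * Real.exp (S * K * G * T) * T with hC
  have hC0 : 0 ≤ C := by positivity
  set ε := (S - m) / (2 * (C + 1)) with hε
  have hε0 : 0 < ε := div_pos (sub_pos.2 hmS) (by positivity)
  have hεC : ε * C ≤ (S - m) / 2 := by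
    rw [hε, div_mul_eq_mul_div, div_le_div_iff₀ (by positivity) two_pos]
    nlinarith
  obtain ⟨l, hl0, hl⟩ := (mem_nhdsLT_iff_exists_Ioo_subset (a := (0:ℝ))).1
    (hGlim.eventually_const_lt (sub_lt_self G hε0))
  have hl0' : l < 0 := hl0
  refine ⟨(S - m) / (2 * N * Real.exp (S * K * G * T)),
    div_pos (sub_pos.2 hmS) (by positivity), fun t ht => ?_⟩
  refine ae_abs_le_of_forall_intervalIntegral_le (hloc t) (δ := -l / (2 * N))
    (div_pos (by linarith) (by positivity)) fun x₁ x₂ hx hxδ => ?_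
  obtain ⟨X, hXC, hXt, hX⟩ := exists_contDiff_characteristic hT hbc hbL hbB ht x₁
  obtain ⟨Y, hYC, hYt, hY⟩ := exists_contDiff_characteristic hT hbc hbL hbB ht x₂
  have hmass := integral_between_characteristics_eq hT hbc hbL hq hq₀ hM hM₀ hsolb hXC hYC hX hY
  have hsub : Icc 0 t ⊆ Icc 0 T := Icc_subset_Icc_right ht.2
  have hXs : ∀ s ∈ Icc 0 t, HasDerivAt X (b s (X s)) s := fun s hs => hX s (hsub hs)
  have hYs : ∀ s ∈ Icc 0 t, HasDerivAt Y (b s (Y s)) s := fun s hs => hY s (hsub hs)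
  have hlt : ∀ s ∈ Icc 0 t, X s < Y s :=
    characteristics_ordered hbL hXs hYs (by rw [hXt, hYt]; exact hx)
  have hgap := characteristics_gap_le hbL ht.2 hXs hYs hlt
  have h0t : (0:ℝ) ∈ Icc 0 t := ⟨le_rfl, ht.1⟩
  have htt : t ∈ Icc 0 t := ⟨ht.1, le_rfl⟩
  have hIS : ∀ s ∈ Icc 0 t, |∫ x in X 0..Y 0, q₀ x| ≤ S * (Y s - X s) := fun s hs => by
    rw [← hmass s (hsub hs)]
    exact abs_intervalIntegral_le_of_ae (hqS s (hsub hs)) (hlt s hs).le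
  rw [← hXt, ← hYt, hmass t ht]
  refine mass_le_of_gap_deriv_ge (d := fun s => Y s - X s) ht K.2 hG0 hS.le hε0.le hN hmS.le
    (fun s hs => (hYs s hs).sub (hXs s hs)) (fun s hs => (hgap s hs).1)
    (sub_pos.2 (hlt 0 h0t)).le (fun s hs => ?_)
    (abs_intervalIntegral_le_of_ae hqm (hlt 0 h0t).le) (hIS t htt) hεC
  have hpos := sub_pos.2 (hlt s hs)
  have hsmall : Y s - X s < -l := by
    refine (hgap s hs).2.trans_lt ?_
    rw [hXt, hYt]
    have h1 := mul_le_mul_of_nonneg_left hxδ (show 0 ≤ N by positivity)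
    have h2 : N * (-l / (2 * N)) = -l / 2 := by field_simp
    linarith
  have hγε : G - ε < γ (X s - Y s) := hl ⟨by linarith, by linarith⟩
  set J := |∫ x in X 0..Y 0, q₀ x| with hJ
  have hJs : J ≤ ∫ y in X s..Y s, |q s y| := by
    rw [hJ, ← hmass s (hsub hs)]
    exact intervalIntegral.abs_integral_le_integral_abs (hlt s hs).le
  have hW := (kernel_increment_bounds hγ.mono hγ.nonneg hγ.integrableOn hG (hqt s).abs
    (fun y => abs_nonneg _) (hqS s (hsub hs)) (hlt s hs).le).2
  change _ ≤ nonlocalTerm γ q s (Y s) - nonlocalTerm γ q s (X s) at hW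
  have hWlow : -(G * (S * (Y s - X s) - J) + ε * S * (Y s - X s)) ≤
      nonlocalTerm γ q s (Y s) - nonlocalTerm γ q s (X s) := by
    have hJ0 : 0 ≤ J := abs_nonneg _
    have h1 : (G - ε) * J ≤ γ (X s - Y s) * ∫ y in X s..Y s, |q s y| :=
      (mul_le_mul_of_nonneg_right hγε.le hJ0).trans
        (mul_le_mul_of_nonneg_left hJs (hγ.nonneg _ (by linarith)))
    have h2 := mul_le_mul_of_nonneg_left (hIS s hs) hε0.le
    linarith
  rw [hbV s (hsub hs), hbV s (hsub hs)]
  have hdef : 0 ≤ G * (S * (Y s - X s) - J) + ε * S * (Y s - X s) :=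
    add_nonneg (mul_nonneg hG0 (sub_nonneg.2 (hIS s hs))) (by positivity)
  have hKdef := mul_nonneg K.coe_nonneg hdef
  rcases le_total (nonlocalTerm γ q s (X s)) (nonlocalTerm γ q s (Y s)) with h | h
  · have := hVmono h
    linarith
  · have h1 := hK.dist_le_mul _ (hmem s (Y s)) _ (hmem s (X s))
    rw [Real.dist_eq, Real.dist_eq, abs_of_nonpos (sub_nonpos.2 h)] at h1
    have h2 := (abs_le.1 h1).1
    have h3 := mul_le_mul_of_nonneg_left hWlow K.coe_nonneg
    linarith

/-- Theorem 3.2, maximum principle for the nonlocal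
conservation law. -/
theorem nonlocal_maximum_principle
    (T : ℝ) (hT : 0 < T)
    (V : ℝ → ℝ) (hV : LocallyLipschitz V) (hVmono : Monotone V)
    (q₀ : ℝ → ℝ) (hq₀meas : Measurable q₀) (hq₀bdd : ∃ M : ℝ, ∀ x, |q₀ x| ≤ M)
    (hq₀BV : BoundedVariationOn q₀ univ)
    (γ : ℝ → ℝ) (hγ : AdmissibleKernel γ)
    (q : ℝ → ℝ → ℝ) (hqClass : InSolutionClass T q)
    (hqSol : IsWeakSolutionNonlocal T V γ q₀ q) :
    ∀ t ∈ Icc (0:ℝ) T, eLpNorm (q t) ⊤ volume ≤ eLpNorm q₀ ⊤ volume := by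
  have hfin : eLpNorm q₀ ⊤ volume ≠ ⊤ := by
    obtain ⟨M, hM⟩ := hq₀bdd
    exact (memLp_top_of_bound hq₀meas.aestronglyMeasurable M (ae_of_all _ hM)).eLpNorm_ne_top
  set m := (eLpNorm q₀ ⊤ volume).toReal with hm
  have hm0 : 0 ≤ m := ENNReal.toReal_nonneg
  have hqm : ∀ᵐ x, |q₀ x| ≤ m := by
    filter_upwards [ae_le_eLpNormEssSup (f := q₀) (μ := volume)] with x hx
    rw [← eLpNorm_exponent_top] at hx
    have h := ENNReal.toReal_mono hfin hx
    rwa [toReal_enorm, Real.norm_eq_abs] at h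
  set A : Set ℝ := {R | m ≤ R ∧ ∀ t ∈ Icc (0:ℝ) T, ∀ᵐ x, |q t x| ≤ R} with hA
  have hAne : A.Nonempty := by
    obtain ⟨M, hM⟩ := hqClass.bdd
    exact ⟨max m M, le_max_left _ _,
      fun t _ => ae_of_all _ fun x => (hM t x).trans (le_max_right _ _)⟩
  have hAbdd : BddBelow A := ⟨m, fun R hR => hR.1⟩
  have hSm : m ≤ sInf A := le_csInf hAne fun R hR => hR.1
  have hSq : ∀ t ∈ Icc (0:ℝ) T, ∀ᵐ x, |q t x| ≤ sInf A := by
    obtain ⟨u, -, hu, huA⟩ := exists_seq_tendsto_sInf hAne hAbdd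
    intro t ht
    filter_upwards [ae_all_iff.2 fun n => (huA n).2 t ht] with x hx
    exact ge_of_tendsto' hu hx
  have hS : sInf A = m := by
    refine (hSm.eq_or_lt.resolve_right fun hlt => ?_).symm
    obtain ⟨κ, hκ, hqκ⟩ := exists_improved_bound hT hV hVmono hq₀meas hq₀bdd hγ hqClass hqSol
      hm0 hlt hqm hSq
    have hmem : max m (sInf A - κ) ∈ A := ⟨le_max_left _ _,
      fun t ht => (hqκ t ht).mono fun x hx => hx.trans (le_max_right _ _)⟩
    exact absurd (csInf_le hAbdd hmem) (not_le.2 (max_lt hlt (by linarith)))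
  intro t ht
  rw [eLpNorm_exponent_top (f := q t), ← ENNReal.ofReal_toReal hfin]
  rw [hS] at hSq
  exact eLpNormEssSup_le_of_ae_bound (hSq t ht)

end
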